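/- arXiv:2505.16732 — 3 statements merged into one kernel-verified Lean document; each statement's English description precedes it below -/
import Mathlib

section
/- Let ν be a σ-finite measure on a measurable space X, φ₀ ∈ ℝ, T ≥ 1, c : X → ℝ a nonnegative measurable function independent of the parameter, and π : ℝ → Fin T → X → ℝ measurable factors with π(φ, t, x) > 0 for all φ in a neighborhood (φ₀ − ε, φ₀ + ε), all t, and ν-a.e. x. Define p(φ, x) = c(x) · ∏_{t=0}^{T−1} π(φ, t, x). Let G : X → ℝ be a nonnegative bounded measurable potential, Z(φ) = ∫ G(x) p(φ, x) dν(x), and assume 0 < Z(φ₀) < ∞. Assume for ν-a.e. x and each t that φ ↦ π(φ, t, x) is differentiable on (φ₀ − ε, φ₀ + ε) with derivative π'(φ, t, x); that x ↦ G(x) p(φ, x) is ν-integrable for each φ in the neighborhood; and that there is a ν-integrable b : X → ℝ with |G(x) · ∂_φ p(φ, x)| ≤ b(x) on the neighborhood ν-a.e. Then φ ↦ log Z(φ) is differentiable at φ₀ with derivative ∫ (∑_{t=0}^{T−1} π'(φ₀, t, x)/π(φ₀, t, x)) dΨ(x), where Ψ = Z(φ₀)⁻¹ • (ν.withDensity (x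 ↦ G(x) p(φ₀, x))). (Proposition 2: the POMDP policy gradient is the posterior expectation of the sum of per-step policy scores.) -/
open MeasureTheory

/-- A pointwise a.e. derivative of an a.e. strongly measurable family is a.e. strongly measurable. -/
theorem aestronglyMeasurable_of_ae_hasDerivAt {X : Type*} [MeasurableSpace X] {ν : Measure X}
    {F : ℝ → X → ℝ} {F' : X → ℝ} {a : ℝ} (hF : ∀ φ, AEStronglyMeasurable (F φ) ν)
    (hF' : ∀ᵐ x ∂ν, HasDerivAt (fun φ => F φ x) (F' x) a) : AEStronglyMeasurable F' ν := by
  refine aestronglyMeasurable_of_tendsto_ae (nhdsWithin a {a}ᶜ)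
    (f := fun φ x => slope (fun ψ => F ψ x) a φ) (fun φ => ?_) ?_
  · simp only [slope_def_module]
    exact ((hF φ).sub (hF a)).const_smul (φ - a)⁻¹
  · filter_upwards [hF'] with x hx
    exact hasDerivAt_iff_tendsto_slope.1 hx

/-- The derivative of a finite product of nonvanishing factors is the product times the sum of the
logarithmic derivatives of the factors. -/
theorem hasDerivAt_prod_mul_sum_div {ι : Type*} {s : Finset ι} {f : ℝ → ι → ℝ} {f' : ι → ℝ} {a : ℝ}
    (hf : ∀ i ∈ s, HasDerivAt (fun φ => f φ i) (f' i) a) (h0 : ∀ i ∈ s, f a i ≠ 0) :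
    HasDerivAt (fun φ => ∏ i ∈ s, f φ i) ((∏ i ∈ s, f a i) * ∑ i ∈ s, f' i / f a i) a := by
  classical
  convert! HasDerivAt.fun_finsetProd (f := fun i φ => f φ i) hf using 1
  rw [Finset.mul_sum]
  refine Finset.sum_congr rfl fun i hi => ?_
  rw [← Finset.prod_erase_mul s _ hi, smul_eq_mul]
  have := h0 i hi
  field_simp

/-- Proposition 2 (POMDP Policy Gradient): for a trajectory density factorizing as
`p φ x = c x * ∏ t, π φ t x` (dynamics factor `c` independent of the parameter, per-step
policy factors `π`), the derivative of the log-normalizing constant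
`Z φ = ∫ G x * p φ x dν` at `φ₀` equals the posterior expectation of the sum of per-step
policy scores `∑ t, π' φ₀ t x / π φ₀ t x` under the reward-tilted posterior
`Ψ = Z(φ₀)⁻¹ • ν.withDensity (x ↦ G x * p φ₀ x)`. -/
theorem pomdp_policy_gradient
    {X : Type*} [MeasurableSpace X] (ν : Measure X) [SigmaFinite ν]
    (φ₀ ε : ℝ) (hε : 0 < ε) (T : ℕ) (hT : 1 ≤ T)
    (c : X → ℝ) (hcmeas : Measurable c) (hcnn : ∀ x, 0 ≤ c x)
    (π π' : ℝ → Fin T → X → ℝ) (hπmeas : ∀ φ t, Measurable (π φ t))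
    (hπpos : ∀ᵐ x ∂ν, ∀ φ ∈ Set.Ioo (φ₀ - ε) (φ₀ + ε), ∀ t, 0 < π φ t x)
    (p p' : ℝ → X → ℝ) (hp : ∀ φ x, p φ x = c x * ∏ t, π φ t x)
    (hπderiv : ∀ᵐ x ∂ν, ∀ t, ∀ φ ∈ Set.Ioo (φ₀ - ε) (φ₀ + ε),
      HasDerivAt (fun ψ => π ψ t x) (π' φ t x) φ)
    (hpderiv : ∀ᵐ x ∂ν, ∀ φ ∈ Set.Ioo (φ₀ - ε) (φ₀ + ε),
      HasDerivAt (fun ψ => p ψ x) (p' φ x) φ)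
    (G : X → ℝ) (hGmeas : Measurable G) (hGnn : ∀ x, 0 ≤ G x)
    (C : ℝ) (hGbd : ∀ x, G x ≤ C)
    (Z : ℝ → ℝ) (hZ : ∀ φ, Z φ = ∫ x, G x * p φ x ∂ν) (hZpos : 0 < Z φ₀)
    (hint : ∀ φ ∈ Set.Ioo (φ₀ - ε) (φ₀ + ε), Integrable (fun x => G x * p φ x) ν)
    (b : X → ℝ) (hb : Integrable b ν)
    (hbound : ∀ᵐ x ∂ν, ∀ φ ∈ Set.Ioo (φ₀ - ε) (φ₀ + ε), |G x * p' φ x| ≤ b x) :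
    HasDerivAt (fun φ => Real.log (Z φ))
      (∫ x, (∑ t, π' φ₀ t x / π φ₀ t x)
        ∂((ENNReal.ofReal (Z φ₀))⁻¹ •
          ν.withDensity (fun x => ENNReal.ofReal (G x * p φ₀ x)))) φ₀ := by
  have hmem : φ₀ ∈ Set.Ioo (φ₀ - ε) (φ₀ + ε) := ⟨by linarith, by linarith⟩
  have hpmeas : ∀ φ, Measurable (p φ) := fun φ => by
    rw [show p φ = fun x => c x * ∏ t, π φ t x from funext (hp φ)]
    exact hcmeas.mul (Finset.measurable_fun_prod _ fun t _ => hπmeas φ t)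
  have hFmeas : ∀ φ, Measurable fun x => G x * p φ x := fun φ => hGmeas.mul (hpmeas φ)
  have hFderiv : ∀ᵐ x ∂ν, ∀ φ ∈ Set.Ioo (φ₀ - ε) (φ₀ + ε),
      HasDerivAt (fun ψ => G x * p ψ x) (G x * p' φ x) φ := by
    filter_upwards [hpderiv] with x hx φ hφ using (hx φ hφ).const_mul _
  have hZderiv : HasDerivAt Z (∫ x, G x * p' φ₀ x ∂ν) φ₀ := by
    rw [show Z = fun φ => ∫ x, G x * p φ x ∂ν from funext hZ]
    exact (hasDerivAt_integral_of_dominated_loc_of_deriv_le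
      (F' := fun φ x => G x * p' φ x) (Ioo_mem_nhds hmem.1 hmem.2)
      (.of_forall fun φ => (hFmeas φ).aestronglyMeasurable) (hint φ₀ hmem)
      (aestronglyMeasurable_of_ae_hasDerivAt (fun φ => (hFmeas φ).aestronglyMeasurable)
        (hFderiv.mono fun x hx => hx φ₀ hmem)) hbound hb hFderiv).2
  have hscore : ∀ᵐ x ∂ν,
      G x * p' φ₀ x = G x * p φ₀ x * ∑ t, π' φ₀ t x / π φ₀ t x := by
    filter_upwards [hπpos, hπderiv, hpderiv] with x hpos hπx hpx
    have h := (hasDerivAt_prod_mul_sum_div (s := Finset.univ) (f := fun φ t => π φ t x)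
      (fun t _ => hπx t φ₀ hmem) fun t _ => (hpos φ₀ hmem t).ne').const_mul (c x)
    simp only [← hp] at h
    rw [(hpx φ₀ hmem).unique h, hp φ₀ x]
    ring
  have hnn : ∀ᵐ x ∂ν, 0 ≤ G x * p φ₀ x := by
    filter_upwards [hπpos] with x hpos
    rw [hp]
    exact mul_nonneg (hGnn x) (mul_nonneg (hcnn x)
      (Finset.prod_nonneg fun t _ => (hpos φ₀ hmem t).le))
  convert hZderiv.log hZpos.ne' using 1
  rw [integral_smul_measure, integral_withDensity_eq_integral_toReal_smul
    (hFmeas φ₀).ennreal_ofReal (.of_forall fun _ => ENNReal.ofReal_lt_top), ENNReal.toReal_inv,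
    ENNReal.toReal_ofReal hZpos.le, smul_eq_mul, div_eq_inv_mul]
  congr 1
  refine integral_congr_ae ?_
  filter_upwards [hscore, hnn] with x hx h0
  rw [hx, ENNReal.toReal_ofReal h0, smul_eq_mul]
end

section
/- Let M, K ≥ 1 be natural numbers, let w be a probability measure on Fin K (the categorical resampling distribution with weights w(k)), let S be a measurable space, and let ν : Fin M → Fin K → Measure S be probability measures (ν m k is the law of the m-th propagated particle given ancestor k). Then sampling the ancestor indices B : Fin M → Fin K independently from w and then the particles independently with laws ν m (B m) yields the same distribution as sampling the particles independently from the mixtures ∑_{k} w(k) • ν m k; that is, (Measure.pi (fun _ : Fin M => w)).bind (fun B => Measure.pi (fun m => ν m (B m))) = Measure.pi (fun m => ∑_{k ∈ Fin K} w {k} • ν m k). (Marginalizing the resampling indices in backward sampling replaces pairwise particle alignment by a product of mixture densities.) -/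
open MeasureTheory

/-- Marginalizing the resampling indices: sampling ancestor indices `B : Fin M → Fin K`
i.i.d. from the categorical distribution `w` and then the particles independently with
laws `ν m (B m)` yields the same joint law as sampling the particles independently from
the mixtures `∑ k, w {k} • ν m k`. -/
theorem marginalize_resampling_indices
    {S : Type*} [MeasurableSpace S] (M K : ℕ) (hM : 1 ≤ M) (hK : 1 ≤ K)
    (w : Measure (Fin K)) [IsProbabilityMeasure w]
    (ν : Fin M → Fin K → Measure S) [∀ m k, IsProbabilityMeasure (ν m k)] :
    (Measure.pi (fun _ : Fin M => w)).bind
        (fun B => Measure.pi (fun m => ν m (B m)))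
      = Measure.pi (fun m => ∑ k : Fin K, w {k} • ν m k) := by
  have hfin (m : Fin M) : IsFiniteMeasure (∑ k : Fin K, w {k} • ν m k) :=
    ⟨by simp [Measure.finsetSum_apply]⟩
  refine (Measure.pi_eq fun s hs => ?_).symm
  rw [Measure.bind_apply (MeasurableSet.univ_pi hs) (measurable_of_finite _).aemeasurable,
    lintegral_fintype]
  simp only [Measure.pi_pi, Measure.pi_singleton, Measure.finsetSum_apply, Measure.smul_apply,
    smul_eq_mul, Fintype.prod_sum, Finset.prod_mul_distrib, mul_comm]
end

section
/- Let μ be a probability measure on a measurable space X, T ≥ 1, and r : Fin T → X → ℝ measurable with 0 ≤ r(t, x) ≤ 1 for all t, x. Let κ be the Markov kernel from X to (Fin T → Bool) given by κ(x) = Measure.pi (fun t => Bernoulli(r(t, x))) (conditionally independent optimality variables O_1, …, O_T given the trajectory), and form the joint probability measure μ ⊗ₘ κ on X × (Fin T → Bool). Assume Z = ∫ ∏_{t} r(t, x) dμ(x) > 0. Then conditioning the joint measure on the event {(x, o) : ∀ t, o(t) = true} and projecting to the first coordinate gives ((μ ⊗ₘ κ)[| {p | ∀ t, p.2 t = true}]).map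 Prod.fst = Z⁻¹ • (μ.withDensity (fun x => ∏_{t} r(t, x))). (The optimality-conditioned trajectory distribution Ψ_T equals the Feynman–Kac tilt of the prior by the product of the per-step potentials.) -/
open MeasureTheory ProbabilityTheory

/-- Restricting `μ ⊗ₘ κ` to the event that the second coordinate lies in `S` and projecting to the
first coordinate reweights `μ` by `x ↦ κ x S`. -/
lemma map_fst_restrict_compProd {X Y : Type*} [MeasurableSpace X] [MeasurableSpace Y]
    (μ : Measure X) [SFinite μ] (κ : Kernel X Y) [IsSFiniteKernel κ]
    {S : Set Y} (hS : MeasurableSet S) :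
    ((μ ⊗ₘ κ).restrict (Prod.snd ⁻¹' S)).map Prod.fst = μ.withDensity (fun x => κ x S) := by
  ext A hA
  rw [Measure.map_apply measurable_fst hA, Measure.restrict_apply (measurable_fst hA),
    withDensity_apply _ hA, ← Set.prod_eq, Measure.compProd_apply_prod hA hS]

/-- The optimality-conditioned trajectory distribution equals the Feynman–Kac tilt of the
prior by the product of per-step potentials: with conditionally independent Bernoulli
optimality variables `O t` (success probability `r t x`) given the trajectory, i.e.
`κ x = Measure.pi (fun t => Bernoulli (r t x))`, and `Z = ∫ ∏ t, r t x dμ > 0`,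
conditioning `μ ⊗ₘ κ` on `{(x, o) : ∀ t, o t = true}` and projecting to the first
coordinate gives `Z⁻¹ • μ.withDensity (fun x => ∏ t, r t x)`. -/
theorem optimality_conditioned_is_feynman_kac_tilt
    {X : Type*} [MeasurableSpace X] (μ : Measure X) [IsProbabilityMeasure μ]
    (T : ℕ) (hT : 1 ≤ T)
    (r : Fin T → X → ℝ) (hrmeas : ∀ t, Measurable (r t))
    (hr0 : ∀ t x, 0 ≤ r t x) (hr1 : ∀ t x, r t x ≤ 1)
    (β : Fin T → X → Measure Bool) (hβprob : ∀ t x, IsProbabilityMeasure (β t x))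
    (hβ : ∀ t x, β t x {true} = ENNReal.ofReal (r t x))
    (κ : Kernel X (Fin T → Bool)) [IsMarkovKernel κ]
    (hκ : ∀ x, κ x = Measure.pi (fun t => β t x))
    (Z : ℝ) (hZdef : Z = ∫ x, ∏ t, r t x ∂μ) (hZpos : 0 < Z) :
    ((μ ⊗ₘ κ)[|{p : X × (Fin T → Bool) | ∀ t, p.2 t = true}]).map Prod.fst
      = (ENNReal.ofReal Z)⁻¹ •
          μ.withDensity (fun x => ENNReal.ofReal (∏ t, r t x)) := by
  have hS : MeasurableSet (Set.univ.pi fun _ : Fin T => ({true} : Set Bool)) :=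
    MeasurableSet.univ_pi fun _ => MeasurableSet.singleton true
  have hE : {p : X × (Fin T → Bool) | ∀ t, p.2 t = true}
      = Prod.snd ⁻¹' (Set.univ.pi fun _ : Fin T => ({true} : Set Bool)) := by
    ext p
    simp
  have hκS (x : X) : κ x (Set.univ.pi fun _ : Fin T => ({true} : Set Bool))
      = ENNReal.ofReal (∏ t, r t x) := by
    rw [hκ, Measure.pi_pi, ENNReal.ofReal_prod_of_nonneg fun t _ => hr0 t x]
    simp only [hβ]
  have hmap := map_fst_restrict_compProd μ κ hS
  simp only [hκS] at hmap
  have hint : Integrable (fun x => ∏ t, r t x) μ :=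
    Integrable.of_integral_ne_zero (hZdef ▸ hZpos.ne')
  have hmass : (μ ⊗ₘ κ) (Prod.snd ⁻¹' (Set.univ.pi fun _ : Fin T => ({true} : Set Bool)))
      = ENNReal.ofReal Z := by
    rw [← Measure.restrict_apply_univ, ← Set.preimage_univ (f := Prod.fst),
      ← Measure.map_apply measurable_fst MeasurableSet.univ, hmap,
      withDensity_apply _ MeasurableSet.univ, Measure.restrict_univ, hZdef,
      ofReal_integral_eq_lintegral_ofReal hint
        (ae_of_all _ fun x => Finset.prod_nonneg fun t _ => hr0 t x)]
  rw [hE, ProbabilityTheory.cond, Measure.map_smul, hmap, hmass]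
end
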